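/- The number of distinct edge trees of height at most 4 is 10, and of height at most 6 is 82. -/

import Mathlib

/-- A subdivided interval (edge tree configuration): each interval is either not
subdivided, or subdivided at the mediant of its endpoints into two subintervals. -/
inductive EdgeTree where
  | leaf : EdgeTree
  | node : EdgeTree → EdgeTree → EdgeTree

/-- The maximal height of a ray of the edge tree `t` built over an edge whose endpoints
have heights `p` and `q`; the new ray of a subdivision has height `p + q`. -/
def edgeMaxH : EdgeTree → ℕ → ℕ → ℕ
  | .leaf, _, _ => 0
  | .node l r, p, q =>
      max (p + q) (max (edgeMaxH l p (p + q)) (edgeMaxH r (p + q) q))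


/-- Trees over the edge `(p, q)` with height at most `N`: finitely many, exactly `n`. -/
def EdgeCount (N p q n : ℕ) : Prop :=
  Finite {t : EdgeTree // edgeMaxH t p q ≤ N} ∧
    Nat.card {t : EdgeTree // edgeMaxH t p q ≤ N} = n

theorem edgeCount_one {N p q : ℕ} (h : N < p + q) : EdgeCount N p q 1 := by
  have hu : ∀ t : {t : EdgeTree // edgeMaxH t p q ≤ N}, t = ⟨.leaf, Nat.zero_le _⟩ := by
    rintro ⟨t, ht⟩
    cases t with
    | leaf => rfl
    | node l r => simp only [edgeMaxH, max_le_iff] at ht; omega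
  haveI : Unique {t : EdgeTree // edgeMaxH t p q ≤ N} := ⟨⟨⟨.leaf, Nat.zero_le _⟩⟩, hu⟩
  exact ⟨inferInstance, Nat.card_unique⟩

/-- A tree is a leaf, or a node with a pair of subtrees. -/
def edgeEquiv {N p q : ℕ} (h : p + q ≤ N) :
    {t : EdgeTree // edgeMaxH t p q ≤ N} ≃
      Option ({t : EdgeTree // edgeMaxH t p (p + q) ≤ N} ×
        {t : EdgeTree // edgeMaxH t (p + q) q ≤ N}) where
  toFun t := match t with
    | ⟨.leaf, _⟩ => none
    | ⟨.node l r, ht⟩ => some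
        (⟨l, (le_max_left _ _).trans ((le_max_right _ _).trans ht)⟩,
          ⟨r, (le_max_right _ _).trans ((le_max_right _ _).trans ht)⟩)
  invFun o := match o with
    | none => ⟨.leaf, Nat.zero_le _⟩
    | some (l, r) => ⟨.node l.1 r.1, max_le h (max_le l.2 r.2)⟩
  left_inv := by
    rintro ⟨t, ht⟩
    cases t <;> rfl
  right_inv := by
    rintro (_ | ⟨l, r⟩) <;> rfl

theorem edgeCount_node {N p q a b : ℕ} (h : p + q ≤ N)
    (ha : EdgeCount N p (p + q) a) (hb : EdgeCount N (p + q) q b) :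
    EdgeCount N p q (a * b + 1) := by
  obtain ⟨fa, ca⟩ := ha
  obtain ⟨fb, cb⟩ := hb
  refine ⟨Finite.of_equiv _ (edgeEquiv h).symm, ?_⟩
  rw [Nat.card_congr (edgeEquiv h), Finite.card_option, Nat.card_prod, ca, cb]

/-- The number of trees computed by recursion with fuel. -/
def edgeNum (N : ℕ) : ℕ → ℕ → ℕ → ℕ
  | 0, _, _ => 1
  | k + 1, p, q =>
      if p + q ≤ N then edgeNum N k p (p + q) * edgeNum N k (p + q) q + 1 else 1

theorem edgeCount_edgeNum (N : ℕ) : ∀ k p q : ℕ, 0 < p → 0 < q → N < p + q + k →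
    EdgeCount N p q (edgeNum N k p q)
  | 0, p, q, _, _, h => edgeCount_one h
  | k + 1, p, q, hp, hq, h => by
    unfold edgeNum
    split_ifs with hN
    · exact edgeCount_node hN
        (edgeCount_edgeNum N k p (p + q) hp (by omega) (by omega))
        (edgeCount_edgeNum N k (p + q) q (by omega) hq (by omega))
    · exact edgeCount_one (by omega)

/-- there are exactly `10` edge trees of height at most `4`, and exactly
`82` edge trees of height at most `6` (over a ground edge whose endpoints have height 1). -/
theorem count_edge_trees_height_le_four_and_six :
    Nat.card {t : EdgeTree // edgeMaxH t 1 1 ≤ 4} = 10 ∧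
    Nat.card {t : EdgeTree // edgeMaxH t 1 1 ≤ 6} = 82 := by
  have h4 := (edgeCount_edgeNum 4 5 1 1 (by omega) (by omega) (by omega)).2
  have h6 := (edgeCount_edgeNum 6 7 1 1 (by omega) (by omega) (by omega)).2
  have e4 : edgeNum 4 5 1 1 = 10 := by decide
  have e6 : edgeNum 6 7 1 1 = 82 := by decide
  exact ⟨h4.trans e4, h6.trans e6⟩
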